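/- arXiv:1507.07993 — 5 statements merged into one kernel-verified Lean document; each statement's English description precedes it below -/
import Mathlib

section
/- Let H be a complex Hilbert space, J a finite nonempty index set, and for each j ∈ J let U_j be a unitary operator on H (e.g. U_j = π(h_j) for a unitary representation π of a group and elements h_j). Set A = ∑_{j ∈ J} U_j and suppose there is C₀ > 0 such that for every φ ∈ H one has Re⟨Aφ, φ⟩ ≤ (1 − C₀)·|J|·‖φ‖². Let κ_j > 0 for j ∈ J, let κ̄ = (1/|J|)·∑_{j ∈ J} κ_j, and suppose K ≥ 1 satisfies max_{j ∈ J} κ_j ≤ K·κ̄. Then the weighted operator Ã = ∑_{j ∈ J} κ_j·U_j satisfies, for every φ ∈ H: Re⟨Ãφ, φ⟩ ≤ κ̄·(1 − C₀ + √(K − 1))·|J|·‖φ‖². -/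
/-- Weighted spectral gap lemma (Lemma 2.5 / `lem:Expand`).
If `A = ∑ⱼ U j` (a sum of unitaries) satisfies `Re⟨Aφ, φ⟩ ≤ (1 − C₀)|J|‖φ‖²`
and the positive weights `κ j` satisfy `max κ j ≤ K·κ̄` with `K ≥ 1`, then the
weighted operator `Ã = ∑ⱼ κ j • U j` satisfies
`Re⟨Ãφ, φ⟩ ≤ κ̄·(1 − C₀ + √(K−1))·|J|·‖φ‖²`. -/
theorem weighted_spectral_gap
    {H : Type*} [NormedAddCommGroup H] [InnerProductSpace ℂ H]
    {J : Type*} [Fintype J] [Nonempty J]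
    (U : J → (H ≃ₗᵢ[ℂ] H))
    (C₀ : ℝ) (hC₀ : 0 < C₀)
    (hA : ∀ φ : H,
      (inner ℂ (∑ j, U j φ) φ : ℂ).re ≤ (1 - C₀) * (Fintype.card J : ℝ) * ‖φ‖ ^ 2)
    (κ : J → ℝ) (hκ : ∀ j, 0 < κ j)
    (K : ℝ) (hK : 1 ≤ K)
    (hmax : ∀ j, κ j ≤ K * ((∑ j, κ j) / (Fintype.card J : ℝ)))
    (φ : H) :
    (inner ℂ (∑ j, (κ j : ℂ) • U j φ) φ : ℂ).re ≤
      ((∑ j, κ j) / (Fintype.card J : ℝ)) * (1 - C₀ + Real.sqrt (K - 1)) *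
        (Fintype.card J : ℝ) * ‖φ‖ ^ 2 := by
  set n : ℝ := (Fintype.card J : ℝ) with hn
  have hnpos : 0 < n := by
    rw [hn]; exact_mod_cast Fintype.card_pos
  set m : ℝ := (∑ j, κ j) / n with hm
  have hsum : ∑ j, κ j = m * n := by rw [hm]; field_simp
  have hmpos : 0 ≤ m := div_nonneg (Finset.sum_nonneg fun j _ => (hκ j).le) hnpos.le
  set x : J → ℝ := fun j => (inner ℂ (U j φ) φ : ℂ).re with hx
  have hxle : ∀ j, |x j| ≤ ‖φ‖ ^ 2 := by
    intro j
    calc |x j| ≤ ‖(inner ℂ (U j φ) φ : ℂ)‖ := Complex.abs_re_le_norm _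
      _ ≤ ‖U j φ‖ * ‖φ‖ := norm_inner_le_norm _ _
      _ = ‖φ‖ ^ 2 := by rw [LinearIsometryEquiv.norm_map, sq]
  have h1 : ∑ j, x j ≤ (1 - C₀) * n * ‖φ‖ ^ 2 := by
    have := hA φ
    rwa [sum_inner, Complex.re_sum] at this
  have h2 : (inner ℂ (∑ j, (κ j : ℂ) • U j φ) φ : ℂ).re = ∑ j, κ j * x j := by
    rw [sum_inner, Complex.re_sum]
    refine Finset.sum_congr rfl fun j _ => ?_
    rw [inner_smul_left, Complex.conj_ofReal, Complex.re_ofReal_mul]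
  have hsq : ∑ j, |κ j - m| ^ 2 ≤ (K - 1) * n * m ^ 2 := by
    have e : ∑ j, |κ j - m| ^ 2 ≤ ∑ j, ((K * m - 2 * m) * κ j + m ^ 2) := by
      refine Finset.sum_le_sum fun j _ => ?_
      rw [sq_abs]
      nlinarith [mul_le_mul_of_nonneg_right (hmax j) (hκ j).le]
    rw [Finset.sum_add_distrib, ← Finset.mul_sum, hsum, Finset.sum_const, Finset.card_univ,
      nsmul_eq_mul, ← hn] at e
    linarith
  have habs : ∑ j, |κ j - m| ≤ m * n * Real.sqrt (K - 1) := by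
    have hc := sq_sum_le_card_mul_sum_sq (s := Finset.univ) (f := fun j => |κ j - m|)
    rw [Finset.card_univ, ← hn] at hc
    refine abs_le_of_sq_le_sq' ?_ (by positivity) |>.2
    rw [mul_pow, Real.sq_sqrt (by linarith)]
    nlinarith [mul_le_mul_of_nonneg_left hsq hnpos.le]
  have h3 : ∑ j, (κ j - m) * x j ≤ (∑ j, |κ j - m|) * ‖φ‖ ^ 2 := by
    rw [Finset.sum_mul]
    refine Finset.sum_le_sum fun j _ => ?_
    calc (κ j - m) * x j ≤ |(κ j - m) * x j| := le_abs_self _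
      _ = |κ j - m| * |x j| := abs_mul _ _
      _ ≤ _ := mul_le_mul_of_nonneg_left (hxle j) (abs_nonneg _)
  have h4 : ∑ j, κ j * x j = ∑ j, (κ j - m) * x j + m * ∑ j, x j := by
    rw [Finset.mul_sum, ← Finset.sum_add_distrib]
    exact Finset.sum_congr rfl fun j _ => by ring
  rw [h2, h4]
  have h5 := mul_le_mul_of_nonneg_left h1 hmpos
  have h6 := mul_le_mul_of_nonneg_right habs (sq_nonneg ‖φ‖)
  linarith
end

section
/- Let G be a finite group, J a finite nonempty index set, and h_j ∈ G for j ∈ J. Suppose there is C₀ ∈ (0, 1] such that for every φ : G → ℂ with ∑_{x ∈ G} φ(x) = 0 one has Re ∑_{j, j' ∈ J} ⟨δ_{h_j·h_{j'}⁻¹} ∗ φ, φ⟩ ≤ (1 − C₀)·|J|²·‖φ‖² (a uniform spectral gap for the unweighted operator). Let κ_j > 0 with max_{j ∈ J} κ_j ≤ K·κ̄, where κ̄ = (1/|J|)·∑_j κ_j and K ≥ 1, and set η = ∑_{j ∈ J} κ_j·δ_{h_j}. Then for every φ : G → ℂ with ∑_{x ∈ G} φ(x) = 0: ‖η ∗ φ‖₂²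 ≤ (1 − C₀ + √(K² − 1))·‖η‖₁²·‖φ‖₂². -/
open scoped BigOperators ComplexConjugate

/-- Convolution of two functions on a finite group:
`(f ∗ g)(x) = ∑_y f(y)·g(y⁻¹x)`. -/
noncomputable def conv {G : Type*} [Group G] [Fintype G] (f g : G → ℂ) : G → ℂ :=
  fun x => ∑ y, f y * g (y⁻¹ * x)

/-- The ℓ¹ norm `‖f‖₁ = ∑_x |f(x)|`. -/
noncomputable def norm1 {G : Type*} [Fintype G] (f : G → ℂ) : ℝ :=
  ∑ x, ‖f x‖

/-- The ℓ² norm `‖f‖₂ = (∑_x |f(x)|²)^{1/2}`. -/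
noncomputable def norm2 {G : Type*} [Fintype G] (f : G → ℂ) : ℝ :=
  Real.sqrt (∑ x, ‖f x‖ ^ 2)

/-- The inner product `⟨f, g⟩ = ∑_x f(x)·conj(g(x))`. -/
noncomputable def innerG {G : Type*} [Fintype G] (f g : G → ℂ) : ℂ :=
  ∑ x, f x * conj (g x)

/-- `δ_g`, the indicator function of the element `g ∈ G`. -/
noncomputable def delta {G : Type*} [DecidableEq G] (g : G) : G → ℂ :=
  fun x => if x = g then 1 else 0

theorem wsg_abstract {E : Type*} [NormedAddCommGroup E] [InnerProductSpace ℂ E]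
    {J : Type*} [Fintype J] [Nonempty J] (v : J → E) (r : ℝ) (hv : ∀ j, ‖v j‖ = r)
    (κ : J → ℝ) (hκ : ∀ j, 0 < κ j) (K : ℝ) (hK : 1 ≤ K)
    (hmax : ∀ j, κ j ≤ K * ((∑ j, κ j) / (Fintype.card J : ℝ)))
    (c : ℝ) (hc : ‖∑ j, v j‖ ^ 2 ≤ c * (Fintype.card J : ℝ) ^ 2 * r ^ 2) :
    ‖∑ j, (κ j : ℂ) • v j‖ ^ 2 ≤ (c + Real.sqrt (K ^ 2 - 1)) * (∑ j, κ j) ^ 2 * r ^ 2 := by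
  have expand : ∀ w : J → ℝ, ‖∑ j, (w j : ℂ) • v j‖ ^ 2 =
      ∑ p : J × J, (w p.1 * w p.2) * (inner ℂ (v p.1) (v p.2)).re := by
    intro w
    rw [← inner_self_eq_norm_sq (𝕜 := ℂ), sum_inner, Fintype.sum_prod_type]
    simp only [inner_sum, inner_smul_left, inner_smul_right, Complex.conj_ofReal, map_sum]
    refine Finset.sum_congr rfl fun i _ => Finset.sum_congr rfl fun j _ => ?_
    simp; ring
  set n : ℝ := (Fintype.card J : ℝ) with hn
  have hnpos : 0 < n := by rw [hn]; exact_mod_cast Fintype.card_pos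
  set S : ℝ := ∑ j, κ j with hS
  have hSpos : 0 < S := Finset.sum_pos (fun j _ => hκ j) Finset.univ_nonempty
  set m : ℝ := S / n with hm
  have hmpos : 0 < m := div_pos hSpos hnpos
  have hSm : S = n * m := by rw [hm]; field_simp
  have h1 := expand κ
  have h2 := expand (fun _ => 1)
  simp only [Complex.ofReal_one, one_smul, one_mul] at h2
  have hsplit : ‖∑ j, (κ j : ℂ) • v j‖ ^ 2 = m ^ 2 * ‖∑ j, v j‖ ^ 2 +
      ∑ p : J × J, (κ p.1 * κ p.2 - m ^ 2) * (inner ℂ (v p.1) (v p.2)).re := by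
    rw [h1, h2, Finset.mul_sum, ← Finset.sum_add_distrib]
    refine Finset.sum_congr rfl fun p _ => by ring
  have hQ : ∑ j, κ j ^ 2 ≤ K * m * S := by
    rw [hS, Finset.mul_sum]
    refine Finset.sum_le_sum fun j _ => ?_
    rw [sq]
    exact mul_le_mul_of_nonneg_right (hmax j) (hκ j).le
  have hQ0 : 0 ≤ ∑ j, κ j ^ 2 := Finset.sum_nonneg fun j _ => sq_nonneg _
  have hA : ∑ p : J × J, (κ p.1 * κ p.2 - m ^ 2) ^ 2 = (∑ j, κ j ^ 2) ^ 2 - n ^ 2 * m ^ 4 := by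
    have e : ∀ p : J × J, (κ p.1 * κ p.2 - m ^ 2) ^ 2 =
      κ p.1 ^ 2 * κ p.2 ^ 2 - 2 * m ^ 2 * (κ p.1 * κ p.2) + m ^ 4 := fun p => by ring
    simp only [e, Finset.sum_add_distrib, Finset.sum_sub_distrib, ← Finset.mul_sum]
    rw [Fintype.sum_prod_type, Fintype.sum_prod_type]
    simp only [← Finset.mul_sum, ← Finset.sum_mul]
    rw [← hS, hSm]
    simp only [Finset.sum_const, Finset.card_univ, Fintype.card_prod, nsmul_eq_mul, Nat.cast_mul,
      ← hn]
    ring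
  have hA' : ∑ p : J × J, (κ p.1 * κ p.2 - m ^ 2) ^ 2 ≤ (K ^ 2 - 1) * (n * m ^ 2) ^ 2 := by
    rw [hA]
    have := pow_le_pow_left₀ hQ0 hQ 2
    rw [hSm] at this
    nlinarith
  have hB : ∑ p : J × J, ((inner ℂ (v p.1) (v p.2)).re) ^ 2 ≤ (n * r ^ 2) ^ 2 := by
    have : ∀ p ∈ (Finset.univ : Finset (J × J)), ((inner ℂ (v p.1) (v p.2)).re) ^ 2 ≤ (r ^ 2) ^ 2 := by
      intro p _
      rw [← sq_abs]
      refine pow_le_pow_left₀ (abs_nonneg _) ?_ 2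
      refine (Complex.abs_re_le_norm _).trans ((norm_inner_le_norm _ _).trans ?_)
      rw [hv, hv, sq]
    refine (Finset.sum_le_sum this).trans (le_of_eq ?_)
    simp only [Finset.sum_const, Finset.card_univ, Fintype.card_prod, nsmul_eq_mul, Nat.cast_mul,
      ← hn]
    ring
  have hK1 : 0 ≤ K ^ 2 - 1 := by nlinarith
  have hCS : ∑ p : J × J, (κ p.1 * κ p.2 - m ^ 2) * (inner ℂ (v p.1) (v p.2)).re ≤
      Real.sqrt (K ^ 2 - 1) * S ^ 2 * r ^ 2 := by
    have := Finset.sum_mul_sq_le_sq_mul_sq (Finset.univ : Finset (J × J))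
      (fun p => κ p.1 * κ p.2 - m ^ 2) (fun p => (inner ℂ (v p.1) (v p.2)).re)
    have h3 := this.trans (mul_le_mul hA' hB (Finset.sum_nonneg fun _ _ => sq_nonneg _) (by positivity))
    refine (abs_le_of_sq_le_sq' ?_ (by positivity)).2
    refine h3.trans (le_of_eq ?_)
    have hs := Real.sq_sqrt hK1
    rw [hSm]
    linear_combination (-(n ^ 4 * m ^ 4 * r ^ 4)) * hs
  rw [hsplit]
  have h4 := mul_le_mul_of_nonneg_left hc (sq_nonneg m)
  have h5 : m ^ 2 * (c * n ^ 2 * r ^ 2) = c * S ^ 2 * r ^ 2 := by rw [hSm]; ring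
  linarith

/-- Left translation. -/
noncomputable def wsgL {G : Type*} [Group G] (g : G) (a : EuclideanSpace ℂ G) :
    EuclideanSpace ℂ G := WithLp.toLp 2 (fun x => a (g⁻¹ * x))

theorem wsgL_inner {G : Type*} [Group G] [Fintype G] (g : G) (a b : EuclideanSpace ℂ G) :
    inner ℂ (wsgL g a) b = inner ℂ a (wsgL g⁻¹ b) := by
  simp only [PiLp.inner_apply, wsgL, inv_inv]
  rw [← Equiv.sum_comp (Equiv.mulLeft g)]
  simp

theorem wsgL_mul {G : Type*} [Group G] (g k : G) (a : EuclideanSpace ℂ G) :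
    wsgL (g * k) a = wsgL g (wsgL k a) := by
  ext x; simp [wsgL, mul_assoc]

theorem wsgL_norm {G : Type*} [Group G] [Fintype G] (g : G) (a : EuclideanSpace ℂ G) :
    ‖wsgL g a‖ = ‖a‖ := by
  simp only [EuclideanSpace.norm_eq, wsgL]
  congr 1
  exact Equiv.sum_comp (Equiv.mulLeft g⁻¹) (fun x => ‖a x‖ ^ 2)

theorem wsg_conv_delta {G : Type*} [Group G] [Fintype G] [DecidableEq G] (g : G) (f : G → ℂ)
    (x : G) : conv (delta g) f x = f (g⁻¹ * x) := by
  simp [conv, delta]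

theorem wsg_norm2 {G : Type*} [Fintype G] (f : G → ℂ) :
    norm2 f = ‖(WithLp.toLp 2 f : EuclideanSpace ℂ G)‖ := by
  simp [norm2, EuclideanSpace.norm_eq]

/-- spectral gap for the weighted measure `η = ∑ⱼ κⱼ·δ_{hⱼ}`
(cf. Theorem `thm:flatExpand`).  If the unweighted operator has a uniform
spectral gap `Re ∑_{j,j'} ⟨δ_{hⱼ hⱼ'⁻¹} ∗ φ, φ⟩ ≤ (1 − C₀)|J|²‖φ‖₂²` on
mean-zero functions, and the positive weights satisfy `max κⱼ ≤ K·κ̄` with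
`K ≥ 1`, then for every mean-zero `φ`:
`‖η ∗ φ‖₂² ≤ (1 − C₀ + √(K² − 1))·‖η‖₁²·‖φ‖₂²`. -/
theorem weighted_measure_spectral_gap
    {G : Type*} [Group G] [Fintype G] [DecidableEq G]
    {J : Type*} [Fintype J] [Nonempty J] (h : J → G)
    (C₀ : ℝ) (hC₀pos : 0 < C₀) (hC₀le : C₀ ≤ 1)
    (hgap : ∀ φ : G → ℂ, (∑ x, φ x) = 0 →
      (∑ j, ∑ j', innerG (conv (delta (h j * (h j')⁻¹)) φ) φ).re ≤
        (1 - C₀) * (Fintype.card J : ℝ) ^ 2 * (norm2 φ) ^ 2)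
    (κ : J → ℝ) (hκ : ∀ j, 0 < κ j)
    (K : ℝ) (hK : 1 ≤ K)
    (hmax : ∀ j, κ j ≤ K * ((∑ j, κ j) / (Fintype.card J : ℝ)))
    (φ : G → ℂ) (hφ : (∑ x, φ x) = 0) :
    (norm2 (conv (fun x => ∑ j, (κ j : ℂ) * delta (h j) x) φ)) ^ 2 ≤
      (1 - C₀ + Real.sqrt (K ^ 2 - 1)) *
        (norm1 (fun x => ∑ j, (κ j : ℂ) * delta (h j) x)) ^ 2 * (norm2 φ) ^ 2 := by
  set a : EuclideanSpace ℂ G := WithLp.toLp 2 φ with ha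
  have hsum : ∀ ψ : EuclideanSpace ℂ G, (∑ x, ψ x) = 0 →
      ‖∑ j, wsgL (h j)⁻¹ ψ‖ ^ 2 ≤ (1 - C₀) * (Fintype.card J : ℝ) ^ 2 * ‖ψ‖ ^ 2 := by
    intro ψ hψ
    have := hgap (fun x => ψ x) hψ
    rw [wsg_norm2] at this
    refine le_trans (le_of_eq ?_) this
    rw [← inner_self_eq_norm_sq (𝕜 := ℂ), sum_inner, ← RCLike.re_eq_complex_re]
    simp only [inner_sum]
    congr 1
    refine Finset.sum_congr rfl fun i _ => Finset.sum_congr rfl fun j _ => ?_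
    rw [wsgL_inner, inv_inv, ← wsgL_mul]
    simp only [innerG, wsg_conv_delta, PiLp.inner_apply, wsgL]
    rfl
  have hc : ‖∑ j, wsgL (h j) a‖ ^ 2 ≤ (1 - C₀) * (Fintype.card J : ℝ) ^ 2 * ‖a‖ ^ 2 := by
    set b := ∑ j, wsgL (h j) a with hb
    have hb0 : ∑ x, b x = 0 := by
      simp only [hb, WithLp.ofLp_sum, Finset.sum_apply]
      rw [Finset.sum_comm]
      refine Finset.sum_eq_zero fun j _ => ?_
      rw [← hφ]
      exact Equiv.sum_comp (Equiv.mulLeft (h j)⁻¹) φ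
    have h1 := hsum b hb0
    have h2 : ‖b‖ ^ 2 ≤ ‖a‖ * ‖∑ j, wsgL (h j)⁻¹ b‖ := by
      have : (inner ℂ b b : ℂ) = inner ℂ a (∑ j, wsgL (h j)⁻¹ b) := by
        conv_lhs => lhs; rw [hb]
        rw [sum_inner, inner_sum]
        exact Finset.sum_congr rfl fun j _ => wsgL_inner _ _ _
      rw [← inner_self_eq_norm_sq (𝕜 := ℂ), this]
      exact (RCLike.re_le_norm _).trans (norm_inner_le_norm _ _)
    have hnn : 0 ≤ (1 - C₀) * (Fintype.card J : ℝ) ^ 2 * ‖a‖ ^ 2 := by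
      have : 0 ≤ 1 - C₀ := by linarith
      positivity
    rcases (sq_nonneg ‖b‖).eq_or_lt with h0 | h0
    · rw [← h0]; exact hnn
    · refine le_of_mul_le_mul_right ?_ h0
      have h3 := pow_le_pow_left₀ h0.le h2 2
      have h4 := mul_le_mul_of_nonneg_left h1 (sq_nonneg ‖a‖)
      nlinarith
  have key := wsg_abstract (fun j => wsgL (h j) a) ‖a‖ (fun j => wsgL_norm _ _) κ hκ K hK hmax
    (1 - C₀) hc
  have hn1 : norm1 (fun x => ∑ j, (κ j : ℂ) * delta (h j) x) = ∑ j, κ j := by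
    have e : ∀ x, ‖∑ j, (κ j : ℂ) * delta (h j) x‖ = ∑ j, (if x = h j then κ j else 0) := by
      intro x
      have : ∑ j, (κ j : ℂ) * delta (h j) x = ((∑ j, (if x = h j then κ j else 0) : ℝ) : ℂ) := by
        push_cast
        refine Finset.sum_congr rfl fun j _ => ?_
        by_cases hx : x = h j <;> simp [delta, hx]
      rw [this, Complex.norm_of_nonneg]
      refine Finset.sum_nonneg fun j _ => ?_
      split_ifs
      exacts [(hκ j).le, le_rfl]
    simp only [norm1, e]
    rw [Finset.sum_comm]
    simp
  have hn2 : norm2 (conv (fun x => ∑ j, (κ j : ℂ) * delta (h j) x) φ) =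
      ‖∑ j, (κ j : ℂ) • wsgL (h j) a‖ := by
    rw [wsg_norm2]
    congr 1
    ext x
    simp only [conv, WithLp.ofLp_sum, Finset.sum_apply, Finset.sum_mul]
    rw [Finset.sum_comm]
    refine Finset.sum_congr rfl fun j _ => ?_
    simp [delta, wsgL, ha]
  rw [hn1, hn2, wsg_norm2 φ]
  exact key
end

section
/- Let T be a positive semidefinite self-adjoint linear operator on a nonzero finite-dimensional complex inner product space, and let m ≥ 1 be such that every nonzero eigenvalue of T has multiplicity (dimension of eigenspace) at least m. Then ‖T‖² ≤ trace(T²)/m, where ‖T‖ is the operator norm. -/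
/-- if `T` is a positive semidefinite self-adjoint operator on a
nonzero finite-dimensional complex inner product space, and every nonzero
eigenvalue of `T` has multiplicity at least `m ≥ 1`, then
`‖T‖² ≤ tr(T²)/m`, where `‖T‖` is the operator norm. -/
theorem opNorm_sq_le_trace_div_mult
    {E : Type*} [NormedAddCommGroup E] [InnerProductSpace ℂ E]
    [FiniteDimensional ℂ E] [Nontrivial E]
    (T : E →ₗ[ℂ] E)
    (hsym : LinearMap.IsSymmetric T)
    (hpos : ∀ x : E, 0 ≤ (inner ℂ (T x) x : ℂ).re)
    (m : ℕ) (hm : 1 ≤ m)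
    (hmult : ∀ μ : ℂ, μ ≠ 0 → Module.End.HasEigenvalue T μ →
      m ≤ Module.finrank ℂ (Module.End.eigenspace T μ)) :
    ‖LinearMap.toContinuousLinearMap T‖ ^ 2 ≤
      (LinearMap.trace ℂ E (T ∘ₗ T)).re / (m : ℝ) := by
  have hn : Module.finrank ℂ E = Module.finrank ℂ E := rfl
  set b := hsym.eigenvectorBasis hn with hb
  set l := hsym.eigenvalues hn with hl
  have happ : ∀ i, T (b i) = (l i : ℂ) • b i := fun i => hsym.apply_eigenvectorBasis hn i
  have htr : (LinearMap.trace ℂ E (T ∘ₗ T)).re = ∑ i, l i ^ 2 := by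
    rw [LinearMap.trace_eq_sum_inner _ b, Complex.re_sum]
    refine Finset.sum_congr rfl fun i _ => ?_
    rw [LinearMap.comp_apply, happ, map_smul, happ, smul_smul, inner_smul_right,
      inner_self_eq_norm_sq_to_K, b.norm_eq_one]
    simp [sq]
  have hne : (Finset.univ : Finset (Fin (Module.finrank ℂ E))).Nonempty :=
    ⟨⟨0, Module.finrank_pos⟩, Finset.mem_univ _⟩
  obtain ⟨i0, -, hmax⟩ := Finset.exists_max_image Finset.univ (fun i => l i ^ 2) hne
  have hnorm : ‖LinearMap.toContinuousLinearMap T‖ ≤ |l i0| := by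
    refine ContinuousLinearMap.opNorm_le_bound _ (abs_nonneg _) fun x => ?_
    refine abs_le_of_sq_le_sq' ?_ (by positivity) |>.2
    rw [mul_pow, sq_abs, ← b.sum_sq_norm_inner_right x, ← b.sum_sq_norm_inner_right,
      Finset.mul_sum]
    refine Finset.sum_le_sum fun i hi => ?_
    have h1 : inner ℂ (b i) (T x) = (l i : ℂ) * inner ℂ (b i) x := by
      rw [← hsym, happ, inner_smul_left, Complex.conj_ofReal]
    rw [LinearMap.coe_toContinuousLinearMap', h1, norm_mul, mul_pow, Complex.norm_real,
      Real.norm_eq_abs, sq_abs]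
    exact mul_le_mul_of_nonneg_right (hmax i hi) (by positivity)
  have hsq : ‖LinearMap.toContinuousLinearMap T‖ ^ 2 ≤ l i0 ^ 2 := by
    rw [← sq_abs (l i0)]
    gcongr
  have hm0 : (0 : ℝ) < m := by exact_mod_cast hm
  refine hsq.trans ?_
  rw [le_div_iff₀ hm0, htr]
  by_cases h0 : l i0 = 0
  · rw [h0]
    simp only [ne_eq, OfNat.ofNat_ne_zero, not_false_eq_true, zero_pow, zero_mul]
    positivity
  have hc := hsym.card_filter_eigenvalues_eq hn (l i0 : ℂ)
  have hmm := hmult (l i0 : ℂ) (by exact_mod_cast h0) (hsym.hasEigenvalue_eigenvalues hn i0)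
  rw [← hc] at hmm
  have hmm' : (m : ℝ) ≤ _ := Nat.cast_le.mpr hmm
  calc l i0 ^ 2 * m ≤ l i0 ^ 2 * _ := mul_le_mul_of_nonneg_left hmm' (sq_nonneg _)
    _ = ∑ i with (l i : ℂ) = (l i0 : ℂ), l i0 ^ 2 := by
      rw [Finset.sum_const, nsmul_eq_mul, mul_comm]; rfl
    _ = ∑ i with (l i : ℂ) = (l i0 : ℂ), l i ^ 2 := by
      refine Finset.sum_congr rfl fun i hi => ?_
      have h2 : l i = l i0 := by exact_mod_cast (Finset.mem_filter.mp hi).2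
      rw [h2]
    _ ≤ ∑ i, l i ^ 2 :=
      Finset.sum_le_sum_of_subset_of_nonneg (Finset.filter_subset _ _)
        fun i _ _ => sq_nonneg _
end

section
/- Let G be a finite group, ν : G → ℝ nonnegative, and let ψ = δ_e − (1/|G|)·𝟙_G, where δ_e is the indicator of the identity and 𝟙_G the constant function 1. Then ψ is mean-zero, ‖ψ‖₂ < 1, and ‖ν̃ ∗ ν‖₂ ≤ ‖ν‖₁²/|G|^{1/2} + ‖ν‖₁·‖ν ∗ ψ‖₂. -/
open scoped BigOperators ComplexConjugate

/-- Convolution of real-valued functions on a finite group. -/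
noncomputable def convR {G : Type*} [Group G] [Fintype G] (f g : G → ℝ) : G → ℝ :=
  fun x => ∑ y, f y * g (y⁻¹ * x)

/-- The ℓ¹ norm of a real-valued function. -/
noncomputable def norm1R {G : Type*} [Fintype G] (f : G → ℝ) : ℝ :=
  ∑ x, |f x|

/-- The ℓ² norm of a real-valued function. -/
noncomputable def norm2R {G : Type*} [Fintype G] (f : G → ℝ) : ℝ :=
  Real.sqrt (∑ x, |f x| ^ 2)

/-- `f̃(x) = f(x⁻¹)` for real-valued `f`. -/
def tildeR {G : Type*} [Group G] (f : G → ℝ) : G → ℝ := fun x => f x⁻¹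

/-- `ψ = δ_e − (1/|G|)·𝟙_G`. -/
noncomputable def psi (G : Type*) [Group G] [Fintype G] [DecidableEq G] : G → ℂ :=
  fun x => (if x = (1 : G) then 1 else 0) - ((Fintype.card G : ℂ))⁻¹

lemma norm2R_eq_norm {G : Type*} [Fintype G] (f : G → ℝ) :
    norm2R f = ‖(WithLp.toLp 2 f : EuclideanSpace ℝ G)‖ := by
  rw [EuclideanSpace.norm_eq]
  simp [norm2R]

lemma conv_psi_apply {G : Type*} [Group G] [Fintype G] [DecidableEq G] (ν : G → ℝ) (x : G) :
    conv (fun x => (ν x : ℂ)) (psi G) x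
      = ((ν x - (∑ y, ν y) * (Fintype.card G : ℝ)⁻¹ : ℝ) : ℂ) := by
  simp only [conv, psi, mul_sub, Finset.sum_sub_distrib, ← Finset.sum_mul, inv_mul_eq_one]
  simp

/-- with `ψ = δ_e − (1/|G|)·𝟙_G`, the function `ψ` is
mean-zero, `‖ψ‖₂ < 1`, and
`‖ν̃ ∗ ν‖₂ ≤ ‖ν‖₁²/|G|^{1/2} + ‖ν‖₁·‖ν ∗ ψ‖₂`. -/
theorem conv_tilde_split
    {G : Type*} [Group G] [Fintype G] [DecidableEq G]
    (ν : G → ℝ) (hν : ∀ g, 0 ≤ ν g) :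
    (∑ x, psi G x) = 0 ∧
    norm2 (psi G) < 1 ∧
    norm2R (convR (tildeR ν) ν) ≤
      (norm1R ν) ^ 2 / Real.sqrt (Fintype.card G : ℝ) +
        norm1R ν * norm2 (conv (fun x => (ν x : ℂ)) (psi G)) := by
  have hn : (0 : ℝ) < (Fintype.card G : ℝ) := by exact_mod_cast Fintype.card_pos
  have hnC : (Fintype.card G : ℂ) ≠ 0 := by exact_mod_cast hn.ne'
  refine ⟨?_, ?_, ?_⟩
  · simp [psi, Finset.sum_sub_distrib, hnC]
  · have h1 : ∀ x : G, ‖psi G x‖ ^ 2 = (if x = (1 : G) then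
        1 - 2 * (Fintype.card G : ℝ)⁻¹ else 0) + ((Fintype.card G : ℝ)⁻¹) ^ 2 := by
      intro x
      have : psi G x = (((if x = (1 : G) then 1 else 0) - (Fintype.card G : ℝ)⁻¹ : ℝ) : ℂ) := by
        simp only [psi]; split_ifs <;> simp
      rw [this, Complex.norm_real, Real.norm_eq_abs, sq_abs]
      split_ifs <;> ring
    have h2 : ∑ x, ‖psi G x‖ ^ 2 = 1 - (Fintype.card G : ℝ)⁻¹ := by
      simp only [h1, Finset.sum_add_distrib]
      simp
      field_simp
      ring
    rw [norm2, h2, Real.sqrt_lt' one_pos]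
    have := inv_pos.mpr hn
    linarith
  · set S := ∑ y, ν y with hS
    have hS1 : norm1R ν = S := by simp [norm1R, abs_of_nonneg (hν _), hS]
    set n : ℝ := (Fintype.card G : ℝ) with hnd
    set w : G → ℝ := fun x => ν x - S * n⁻¹ with hw
    have hW : norm2 (conv (fun x => (ν x : ℂ)) (psi G)) = norm2R w := by
      simp only [norm2, norm2R, conv_psi_apply, Complex.norm_real, Real.norm_eq_abs]
      rfl
    have hshift : ∀ z : G, norm2R (fun x => w (z * x)) = norm2R w := by
      intro z
      simp only [norm2R]
      congr 1
      exact Equiv.sum_comp (Equiv.mulLeft z) (fun x => |w x| ^ 2)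
    have hconst : norm2R (fun _ : G => S ^ 2 * n⁻¹) = S ^ 2 / Real.sqrt n := by
      simp only [norm2R, Finset.sum_const, Finset.card_univ, nsmul_eq_mul, ← hnd, sq_abs]
      have : n * (S ^ 2 * n⁻¹) ^ 2 = (S ^ 2) ^ 2 / n := by field_simp
      rw [this, Real.sqrt_div (by positivity), Real.sqrt_sq (by positivity)]
    have hdec : (WithLp.toLp 2 (convR (tildeR ν) ν) : EuclideanSpace ℝ G)
        = WithLp.toLp 2 (fun _ : G => S ^ 2 * n⁻¹)
          + ∑ z, ν z • (WithLp.toLp 2 (fun x => w (z * x)) : EuclideanSpace ℝ G) := by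
      ext x
      have h3 : convR (tildeR ν) ν x = ∑ z, ν z * ν (z * x) := by
        simp only [convR, tildeR]
        exact Equiv.sum_comp (Equiv.inv G) (fun z => ν z * ν (z * x))
      simp only [PiLp.add_apply, WithLp.ofLp_sum, Finset.sum_apply, PiLp.smul_apply,
        WithLp.ofLp_smul, Pi.smul_apply, smul_eq_mul, h3, hw, mul_sub, Finset.sum_sub_distrib,
        ← Finset.sum_mul, ← hS]
      ring
    rw [hS1, hW, ← hconst, norm2R_eq_norm, hdec, norm2R_eq_norm (fun _ : G => S ^ 2 * n⁻¹)]
    refine (norm_add_le _ _).trans (add_le_add le_rfl ((norm_sum_le _ _).trans (le_of_eq ?_)))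
    rw [hS, Finset.sum_mul]
    refine Finset.sum_congr rfl fun z _ => ?_
    rw [norm_smul, Real.norm_eq_abs, abs_of_nonneg (hν z), ← norm2R_eq_norm, hshift]
end

section
/- Let G be a finite group and ν : G → ℝ nonnegative. Suppose ε > 0 satisfies ε ≤ |G|^{-1/2} and for every φ : G → ℂ with ∑_{x ∈ G} φ(x) = 0 one has ‖ν ∗ φ‖₂ ≤ ε·‖ν‖₁·‖φ‖₂. Then ‖ν̃ ∗ ν‖₂ ≤ 2·‖ν‖₁² / |G|^{1/2}. -/
open scoped BigOperators

theorem real_gap_aux {G : Type*} [Group G] [Fintype G]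
    (ν : G → ℝ)
    (ε : ℝ) (hε : 0 < ε) (hε' : ε ≤ 1 / Real.sqrt (Fintype.card G : ℝ))
    (hgap : ∀ φ : G → ℂ, (∑ x, φ x) = 0 →
      norm2 (conv (fun x => (ν x : ℂ)) φ) ≤ ε * norm1R ν * norm2 φ)
    (φ : G → ℝ) (hφ : ∑ x, φ x = 0) :
    ∑ x, (convR ν φ x) ^ 2 ≤ (norm1R ν) ^ 2 / (Fintype.card G : ℝ) * ∑ x, φ x ^ 2 := by
  have h := hgap (fun x => (φ x : ℂ)) (by exact_mod_cast hφ)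
  have e1 : ∀ x, conv (fun x => (ν x : ℂ)) (fun x => (φ x : ℂ)) x = ((convR ν φ x : ℝ) : ℂ) := by
    intro x
    simp [conv, convR]
  have hS : 0 ≤ norm1R ν := Finset.sum_nonneg fun _ _ => abs_nonneg _
  unfold norm2 at h
  simp only [e1, Complex.norm_real, Real.norm_eq_abs, sq_abs] at h
  have hA : 0 ≤ ∑ x, (convR ν φ x) ^ 2 := Finset.sum_nonneg fun _ _ => sq_nonneg _
  have hB : 0 ≤ ∑ x, φ x ^ 2 := Finset.sum_nonneg fun _ _ => sq_nonneg _
  have h2 := pow_le_pow_left₀ (Real.sqrt_nonneg _) h 2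
  rw [Real.sq_sqrt hA, mul_pow, Real.sq_sqrt hB, mul_pow] at h2
  have h3 := pow_le_pow_left₀ hε.le hε' 2
  rw [div_pow, Real.sq_sqrt (Nat.cast_nonneg _), one_pow] at h3
  refine h2.trans ?_
  refine mul_le_mul_of_nonneg_right ?_ hB
  calc ε ^ 2 * norm1R ν ^ 2 ≤ 1 / (Fintype.card G : ℝ) * norm1R ν ^ 2 :=
        mul_le_mul_of_nonneg_right h3 (sq_nonneg _)
    _ = _ := by ring

theorem sum_sub_const_sq_aux {G : Type*} [Group G] [Fintype G] (f : G → ℝ) (S : ℝ)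
    (hf : ∑ x, f x = S) :
    ∑ x, (f x - S / (Fintype.card G : ℝ)) ^ 2 = ∑ x, f x ^ 2 - S ^ 2 / (Fintype.card G : ℝ) := by
  have hN : (Fintype.card G : ℝ) ≠ 0 := by exact_mod_cast Fintype.card_ne_zero
  simp only [sub_sq, Finset.sum_add_distrib, Finset.sum_sub_distrib, ← Finset.sum_mul,
    ← Finset.mul_sum, hf, Finset.sum_const, Finset.card_univ, nsmul_eq_mul]
  field_simp
  ring

theorem sum_sub_const_aux {G : Type*} [Group G] [Fintype G] (f : G → ℝ) (S : ℝ)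
    (hf : ∑ x, f x = S) :
    ∑ x, (f x - S / (Fintype.card G : ℝ)) = 0 := by
  have hN : (Fintype.card G : ℝ) ≠ 0 := by exact_mod_cast Fintype.card_ne_zero
  simp only [Finset.sum_sub_distrib, hf, Finset.sum_const, Finset.card_univ, nsmul_eq_mul]
  field_simp
  ring

theorem adjoint_aux {G : Type*} [Group G] [Fintype G] (ν h : G → ℝ) :
    ∑ x, h x * convR (tildeR ν) ν x = ∑ z, ν z * convR ν h z := by
  simp only [convR, tildeR, Finset.mul_sum]
  rw [Finset.sum_comm, Finset.sum_comm (f := fun z y => ν z * (ν y * h (y⁻¹ * z)))]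
  rw [← Equiv.sum_comp (Equiv.inv G)]
  refine Finset.sum_congr rfl fun y _ => ?_
  rw [← Equiv.sum_comp (Equiv.mulLeft y) (fun z => ν z * (ν y * h (y⁻¹ * z)))]
  refine Finset.sum_congr rfl fun x _ => ?_
  simp
  ring

theorem sum_conv_aux {G : Type*} [Group G] [Fintype G] (f g : G → ℝ) :
    ∑ x, convR f g x = (∑ x, f x) * ∑ x, g x := by
  simp only [convR]
  rw [Finset.sum_comm, Finset.sum_mul]
  refine Finset.sum_congr rfl fun y _ => ?_
  rw [← Finset.mul_sum]
  congr 1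
  exact Equiv.sum_comp (Equiv.mulLeft y⁻¹) g

/-- cf. the Proposition giving `‖ν̃ ∗ ν‖₂ ≤ 2‖ν‖₁²/|G|^{1/2}`:
if `ν ≥ 0` and `0 < ε ≤ |G|^{-1/2}` is such that
`‖ν ∗ φ‖₂ ≤ ε·‖ν‖₁·‖φ‖₂` for every mean-zero `φ`, then
`‖ν̃ ∗ ν‖₂ ≤ 2·‖ν‖₁²/|G|^{1/2}`. -/
theorem conv_tilde_smallness
    {G : Type*} [Group G] [Fintype G]
    (ν : G → ℝ) (hν : ∀ g, 0 ≤ ν g)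
    (ε : ℝ) (hε : 0 < ε) (hε' : ε ≤ 1 / Real.sqrt (Fintype.card G : ℝ))
    (hgap : ∀ φ : G → ℂ, (∑ x, φ x) = 0 →
      norm2 (conv (fun x => (ν x : ℂ)) φ) ≤ ε * norm1R ν * norm2 φ) :
    norm2R (convR (tildeR ν) ν) ≤
      2 * (norm1R ν) ^ 2 / Real.sqrt (Fintype.card G : ℝ) := by
  classical
  have gap := real_gap_aux ν ε hε hε' hgap
  have hS : ∑ x, ν x = norm1R ν := Finset.sum_congr rfl fun x _ => (abs_of_nonneg (hν x)).symm
  have hS0 : 0 ≤ norm1R ν := Finset.sum_nonneg fun _ _ => abs_nonneg _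
  generalize norm1R ν = S at *
  have hN1 : (1 : ℝ) ≤ Fintype.card G := by exact_mod_cast Fintype.card_pos
  -- bound on the square norm of ν
  have hδ : ∑ x : G, (if x = 1 then (1 : ℝ) else 0) = 1 := by simp
  have hν2 : ∑ x, ν x ^ 2 ≤ 2 * (S ^ 2 / (Fintype.card G : ℝ)) := by
    have h1 := gap (fun x => (if x = 1 then (1 : ℝ) else 0) - 1 / (Fintype.card G : ℝ))
      (sum_sub_const_aux _ 1 hδ)
    rw [sum_sub_const_sq_aux _ 1 hδ] at h1
    have e : ∀ x, convR ν (fun x => (if x = 1 then (1 : ℝ) else 0) - 1 / (Fintype.card G : ℝ)) x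
        = ν x - S / (Fintype.card G : ℝ) := by
      intro x
      simp only [convR, mul_sub, Finset.sum_sub_distrib, ← Finset.sum_mul, hS, inv_mul_eq_one]
      simp
      ring
    simp only [e] at h1
    rw [sum_sub_const_sq_aux _ S hS] at h1
    have h2 : ∑ x : G, (if x = 1 then (1 : ℝ) else 0) ^ 2 = 1 := by simp
    rw [h2] at h1
    have h3 : 0 ≤ S ^ 2 / (Fintype.card G : ℝ) := by positivity
    have h4 : 0 ≤ 1 ^ 2 / (Fintype.card G : ℝ) := by positivity
    nlinarith [mul_nonneg h3 h4]
  have hρ : ∑ x, convR (tildeR ν) ν x = S ^ 2 := by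
    rw [sum_conv_aux, hS, sq]
    congr 1
    rw [← hS]
    exact Equiv.sum_comp (Equiv.inv G) ν
  have hsq := sum_sub_const_sq_aux _ _ hρ
  have hz := sum_sub_const_aux _ _ hρ
  have hadj := adjoint_aux ν (fun x => convR (tildeR ν) ν x - S ^ 2 / (Fintype.card G : ℝ))
  have hg := gap _ hz
  have hcs := Finset.sum_mul_sq_le_sq_mul_sq Finset.univ ν
    (convR ν (fun x => convR (tildeR ν) ν x - S ^ 2 / (Fintype.card G : ℝ)))
  rw [← hadj] at hcs
  have hA : ∑ x, (convR (tildeR ν) ν x - S ^ 2 / (Fintype.card G : ℝ)) * convR (tildeR ν) ν x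
      = ∑ x, (convR (tildeR ν) ν x - S ^ 2 / (Fintype.card G : ℝ)) ^ 2 := by
    have : ∑ x, (convR (tildeR ν) ν x - S ^ 2 / (Fintype.card G : ℝ)) *
      (S ^ 2 / (Fintype.card G : ℝ)) = 0 := by rw [← Finset.sum_mul, hz, zero_mul]
    rw [← sub_zero (∑ x, _ * _), ← this, ← Finset.sum_sub_distrib]
    exact Finset.sum_congr rfl fun x _ => by ring
  rw [hA] at hcs
  have hA0 : 0 ≤ ∑ x, (convR (tildeR ν) ν x - S ^ 2 / (Fintype.card G : ℝ)) ^ 2 :=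
    Finset.sum_nonneg fun _ _ => sq_nonneg _
  generalize ∑ x, (convR (tildeR ν) ν x - S ^ 2 / (Fintype.card G : ℝ)) ^ 2 = A at *
  have hq : 0 ≤ S ^ 2 / (Fintype.card G : ℝ) := by positivity
  have hAle : A ≤ 2 * (S ^ 2 / (Fintype.card G : ℝ)) ^ 2 := by
    have h5 := hcs.trans (mul_le_mul hν2 hg (Finset.sum_nonneg fun _ _ => sq_nonneg _)
      (by positivity))
    rcases hA0.eq_or_lt with h0 | h0
    · rw [← h0]; positivity
    · refine le_of_mul_le_mul_right ?_ h0
      linarith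
  have hle : (S ^ 2 / (Fintype.card G : ℝ)) ^ 2 ≤ (S ^ 2) ^ 2 / (Fintype.card G : ℝ) := by
    rw [div_pow]
    exact div_le_div_of_nonneg_left (by positivity) (by positivity) (by nlinarith)
  have hpos : 0 ≤ (S ^ 2) ^ 2 / (Fintype.card G : ℝ) := by positivity
  unfold norm2R
  simp only [sq_abs]
  apply Real.sqrt_le_iff.2
  refine ⟨by positivity, ?_⟩
  rw [div_pow, Real.sq_sqrt (by positivity)]
  have : (2 * S ^ 2) ^ 2 / (Fintype.card G : ℝ) = 4 * ((S ^ 2) ^ 2 / (Fintype.card G : ℝ)) := by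
    ring
  rw [this]
  linarith
end
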